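/- Let X = (Γ,|B|,K) and X̃ = (Γ̃,|B̃|,K̃) be labeled graphs, with vertex and oriented-edge sets V, W and Ṽ, W̃ respectively, and suppose given a covering datum: a surjective map p : Ṽ → V and a map p : W̃ → W satisfying p(−w̃) = −p(w̃) and p(w̃⁻) = p(w̃)⁻ for all w̃ ∈ W̃, together with positive integers d_ṽ (ṽ ∈ Ṽ), such that: |b̃_{w̃}| = |b_{p(w̃)}| for all w̃ ∈ W̃; k̃_ṽ = d_ṽ·k_{p(ṽ)} for all ṽ ∈ Ṽ; and for every ṽ ∈ Ṽ and every w ∈ ∂(p(ṽ)), the number of edges w̃ ∈ ∂ṽ with p(w̃) = w equals d_ṽ. Then: if the BKN-equation over X̃ has a compatible symmetric solution, so does the BKN-equation over X; if the BKN-equation over X̃ has a compatible symmetric solution with positive length function (ã_ṽ > 0 for all ṽ ∈ Ṽ), then the BKN-equation over X has a compatible symmetric solution with positive length function; and if the BKN-equation over X̃ has an NPC-solution, then the BKN-equation over X has an NPC-solution. -/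

import Mathlib

open Finset Matrix

/-- A labeled graph `X = (Γ, |B|, K)`: a finite connected graph with oriented edge set `W`
(carrying the fixed-point-free orientation-reversal involution `rev` and initial-vertex map
`ini`), positive integer weights `b` on oriented edges with `b (rev w) = b w`, and real
charges `k` on vertices. -/
structure LabeledGraph (V W : Type) [Fintype V] [DecidableEq V] [Fintype W] [DecidableEq W] where
  rev : W → W
  rev_invol : ∀ w, rev (rev w) = w
  rev_ne : ∀ w, rev w ≠ w
  ini : W → V
  b : W → ℕ
  b_pos : ∀ w, 0 < b w
  b_symm : ∀ w, b (rev w) = b w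
  k : V → ℝ
  edges_nonempty : Nonempty W
  connected : ∀ u v : V,
    Relation.ReflTransGen (fun x y => ∃ w, ini w = x ∧ ini (rev w) = y) u v

namespace LabeledGraph

variable {V W : Type} [Fintype V] [DecidableEq V] [Fintype W] [DecidableEq W]

/-- The terminal vertex `w⁺ = (-w)⁻` of an oriented edge. -/
def ter (X : LabeledGraph V W) (w : W) : V := X.ini (X.rev w)

/-- The BKN-equation over `X`: `k_v · a_v = Σ_{w ∈ ∂v} (γ_w/|b_w|) · a_{w⁺}` for all `v`. -/
def BKN (X : LabeledGraph V W) (a : V → ℝ) (γ : W → ℝ) : Prop :=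
  ∀ v : V, X.k v * a v =
    ∑ w ∈ univ.filter (fun w => X.ini w = v), γ w / (X.b w : ℝ) * a (X.ter w)

/-- Compatibility of a solution `(a,γ)`. -/
def Compatible (X : LabeledGraph V W) (a : V → ℝ) (γ : W → ℝ) : Prop :=
  (∀ v, 0 ≤ a v) ∧ a ≠ 0 ∧ (∀ w, |γ w| ≤ 1) ∧
    (∀ w, |γ w * γ (X.rev w)| = 1 → γ (X.rev w) = γ w) ∧
    (∀ v, a v = 0 → ∀ w, X.ini w = v → γ w = 0 ∧ γ (X.rev w) = 0)

/-- The angle function is symmetric: `γ_{-w} = γ_w`. -/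
def SymSol (X : LabeledGraph V W) (γ : W → ℝ) : Prop := ∀ w, γ (X.rev w) = γ w

/-- An NPC-solution: a compatible symmetric solution with positive length function and
`|γ| < 1`. -/
def NPCSolution (X : LabeledGraph V W) (a : V → ℝ) (γ : W → ℝ) : Prop :=
  X.BKN a γ ∧ X.Compatible a γ ∧ X.SymSol γ ∧ (∀ v, 0 < a v) ∧ ∀ w, |γ w| < 1

/-- The operator `A⁺ = D⁺ − J` on `ℝ^V`. -/
noncomputable def Aplus (X : LabeledGraph V W) : Matrix V V ℝ :=
  Matrix.of fun v v' =>
    (if v = v' then |X.k v| else 0)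
      - ∑ w ∈ univ.filter (fun w => X.ini w = v ∧ X.ter w = v'), (1 : ℝ) / (X.b w)

/-- The operator `A_λ = D − J_λ` on `ℝ^V` for a (symmetric `±1`-valued) function `λ` on `W`. -/
noncomputable def Aop (X : LabeledGraph V W) (lam : W → ℝ) : Matrix V V ℝ :=
  Matrix.of fun v v' =>
    (if v = v' then X.k v else 0)
      - ∑ w ∈ univ.filter (fun w => X.ini w = v ∧ X.ter w = v'), lam w / (X.b w : ℝ)

/-- Two vertices lie in the same sign component. -/
def SameSign (X : LabeledGraph V W) : V → V → Prop :=
  Relation.ReflTransGen fun x y =>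
    (∃ w, X.ini w = x ∧ X.ter w = y) ∧ 0 < X.k x * X.k y

/-- A `±1`-valued sign function `s` of type (ii): constant on sign components, alternating
along edges joining distinct sign components, and equal to `1` at some vertex of positive
charge. -/
def TypeII (X : LabeledGraph V W) (s : V → ℝ) : Prop :=
  (∀ v, s v = 1 ∨ s v = -1) ∧
    (∀ u v, X.SameSign u v → s u = s v) ∧
    (∀ w, ¬ X.SameSign (X.ini w) (X.ter w) → s (X.ini w) = - s (X.ter w)) ∧
    (∃ v, s v = 1 ∧ 0 < X.k v)

/-- An admissible sign function: of type (ii), or identically zero when no type (ii)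
function exists. -/
def Admissible (X : LabeledGraph V W) (s : V → ℝ) : Prop :=
  X.TypeII s ∨ (s = 0 ∧ ¬ ∃ s', X.TypeII s')

open scoped Classical in
/-- The operator `H = D_s − J₀` associated with an admissible sign function `s`; only
oriented edges with both endpoints in one and the same sign component contribute. -/
noncomputable def Hop (X : LabeledGraph V W) (s : V → ℝ) : Matrix V V ℝ :=
  Matrix.of fun v v' =>
    (if v = v' then s v * X.k v else 0)
      - ∑ w ∈ univ.filter
          (fun w => X.ini w = v ∧ X.ter w = v' ∧ X.SameSign (X.ini w) (X.ter w)),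
          (1 : ℝ) / (X.b w)

/-- `A` has a nonpositive real eigenvalue. -/
def HasNonposEigenvalue (A : Matrix V V ℝ) : Prop :=
  ∃ μ : ℝ, μ ≤ 0 ∧ ∃ x : V → ℝ, x ≠ 0 ∧ A.mulVec x = μ • x

/-- `A` has a negative real eigenvalue. -/
def HasNegEigenvalue (A : Matrix V V ℝ) : Prop :=
  ∃ μ : ℝ, μ < 0 ∧ ∃ x : V → ℝ, x ≠ 0 ∧ A.mulVec x = μ • x

/-- `A` is positive semidefinite: `(Ax,x) ≥ 0` for all `x`. -/
def PosSemidef' (A : Matrix V V ℝ) : Prop := ∀ x : V → ℝ, 0 ≤ x ⬝ᵥ A.mulVec x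

/-- `A` is singular: it has a nontrivial kernel. -/
def Singular (A : Matrix V V ℝ) : Prop := ∃ x : V → ℝ, x ≠ 0 ∧ A.mulVec x = 0

/-- `A` is supersingular: its kernel contains a vector with all coordinates nonzero. -/
def Supersingular (A : Matrix V V ℝ) : Prop :=
  ∃ x : V → ℝ, (∀ v, x v ≠ 0) ∧ A.mulVec x = 0

/-- `A` is weakly singular: there is a nonzero `x` with `(Ax)_v = 0` at every vertex of the
support of `x`. -/
def WeaklySingular (A : Matrix V V ℝ) : Prop :=
  ∃ x : V → ℝ, x ≠ 0 ∧ ∀ v, x v ≠ 0 → A.mulVec x v = 0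

end LabeledGraph

namespace LabeledGraph

section PushLength

variable {V V' : Type} [Fintype V'] [DecidableEq V]

/-- The length function on the base: the `ℓ²`-norm of `a` on each fiber, weighted by the local
degrees. -/
noncomputable def pushLength (pV : V' → V) (d : V' → ℕ) (a : V' → ℝ) (v : V) : ℝ :=
  √(∑ v' with pV v' = v, (d v' : ℝ) * a v' ^ 2)

lemma pushLength_nonneg (pV : V' → V) (d : V' → ℕ) (a : V' → ℝ) (v : V) :
    0 ≤ pushLength pV d a v :=
  Real.sqrt_nonneg _

lemma sq_pushLength (pV : V' → V) (d : V' → ℕ) (a : V' → ℝ) (v : V) :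
    pushLength pV d a v ^ 2 = ∑ v' with pV v' = v, (d v' : ℝ) * a v' ^ 2 :=
  Real.sq_sqrt (sum_nonneg fun _ _ => by positivity)

end PushLength

variable {V W V' W' : Type} [Fintype V'] [DecidableEq V'] [Fintype W'] [DecidableEq W']
  [Fintype V] [DecidableEq V] [Fintype W] [DecidableEq W]

/-- `pV`, `pW`, `d` form a covering datum from the labeled graph `Y` to the labeled graph `X`. -/
structure IsCovering (X : LabeledGraph V W) (Y : LabeledGraph V' W')
    (pV : V' → V) (pW : W' → W) (d : V' → ℕ) : Prop where
  surjective : Function.Surjective pV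
  map_rev : ∀ w', pW (Y.rev w') = X.rev (pW w')
  map_ini : ∀ w', pV (Y.ini w') = X.ini (pW w')
  degree_pos : ∀ v', 0 < d v'
  map_b : ∀ w', Y.b w' = X.b (pW w')
  map_k : ∀ v', Y.k v' = (d v' : ℝ) * X.k (pV v')
  card_fiber : ∀ (u : V') (w : W), X.ini w = pV u →
    (univ.filter (fun e => Y.ini e = u ∧ pW e = w)).card = d u

/-- The sum of `γ_w̃ · a_{w̃⁻} · a_{w̃⁺}` over the edges `w̃` above `w`. -/
def pushPairing (Y : LabeledGraph V' W') (pW : W' → W) (a : V' → ℝ) (γ : W' → ℝ) (w : W) : ℝ :=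
  ∑ e with pW e = w, γ e * (a (Y.ini e) * a (Y.ter e))

/-- The angle function on the base: the pairing of lengths above `w`, normalized by the lengths of
the endpoints of `w`. -/
noncomputable def pushAngle (X : LabeledGraph V W) (Y : LabeledGraph V' W')
    (pV : V' → V) (pW : W' → W) (d : V' → ℕ) (a : V' → ℝ) (γ : W' → ℝ) (w : W) : ℝ :=
  pushPairing Y pW a γ w / (pushLength pV d a (X.ini w) * pushLength pV d a (X.ter w))

lemma ter_rev (X : LabeledGraph V W) (w : W) : X.ter (X.rev w) = X.ini w := by
  rw [ter, X.rev_invol]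

namespace IsCovering

variable {X : LabeledGraph V W} {Y : LabeledGraph V' W'} {pV : V' → V} {pW : W' → W} {d : V' → ℕ}
  {a : V' → ℝ} {γ : W' → ℝ}

lemma pushLength_pos (h : IsCovering X Y pV pW d) {v' : V'} (ha : a v' ≠ 0) :
    0 < pushLength pV d a (pV v') := by
  refine Real.sqrt_pos.2 (sum_pos' (fun _ _ => by positivity) ⟨v', by simp, ?_⟩)
  have := h.degree_pos v'
  positivity

lemma eq_zero_of_pushLength_eq_zero (h : IsCovering X Y pV pW d) {v' : V'}
    (h0 : pushLength pV d a (pV v') = 0) : a v' = 0 := by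
  by_contra ha
  exact (h.pushLength_pos ha).ne' h0

lemma map_ter (h : IsCovering X Y pV pW d) (w' : W') : pV (Y.ter w') = X.ter (pW w') := by
  rw [ter, ter, h.map_ini, h.map_rev]

lemma sum_fiber_ini (h : IsCovering X Y pV pW d) (g : V' → ℝ) (w : W) :
    ∑ w' with pW w' = w, g (Y.ini w') = ∑ v' with pV v' = X.ini w, (d v' : ℝ) * g v' := by
  rw [← sum_fiberwise_of_maps_to (g := Y.ini) (t := univ.filter fun v' => pV v' = X.ini w)]
  · refine sum_congr rfl fun v' hv' => ?_
    rw [mem_filter] at hv'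
    rw [← h.card_fiber v' w hv'.2.symm, ← nsmul_eq_mul, filter_filter,
      filter_congr fun w' _ => and_comm (a := pW w' = w)]
    exact sum_eq_card_nsmul fun w' hw' => by rw [(mem_filter.1 hw').2.1]
  · intro w' hw'
    simp only [mem_filter, mem_univ, true_and] at hw' ⊢
    rw [h.map_ini, hw']

lemma sum_fiber_rev (h : IsCovering X Y pV pW d) (g : W' → ℝ) (w : W) :
    ∑ w' with pW w' = X.rev w, g w' = ∑ w' with pW w' = w, g (Y.rev w') := by
  refine sum_nbij' Y.rev Y.rev ?_ ?_ ?_ ?_ ?_ <;> intro w' hw' <;>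
    simp_all [h.map_rev, X.rev_invol, Y.rev_invol]

lemma sum_sq_ini (h : IsCovering X Y pV pW d) (a : V' → ℝ) (w : W) :
    ∑ w' with pW w' = w, a (Y.ini w') ^ 2 = pushLength pV d a (X.ini w) ^ 2 := by
  rw [sq_pushLength, h.sum_fiber_ini (fun v' => a v' ^ 2)]

lemma sum_sq_ter (h : IsCovering X Y pV pW d) (a : V' → ℝ) (w : W) :
    ∑ w' with pW w' = w, a (Y.ter w') ^ 2 = pushLength pV d a (X.ter w) ^ 2 := by
  rw [ter, ← h.sum_sq_ini, h.sum_fiber_rev]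
  rfl

lemma sum_mul_le (h : IsCovering X Y pV pW d) (a : V' → ℝ) (w : W) :
    ∑ w' with pW w' = w, a (Y.ini w') * a (Y.ter w') ≤
      pushLength pV d a (X.ini w) * pushLength pV d a (X.ter w) := by
  refine abs_le_of_sq_le_sq' ?_ (mul_nonneg (pushLength_nonneg ..) (pushLength_nonneg ..)) |>.2
  rw [mul_pow, ← h.sum_sq_ini, ← h.sum_sq_ter]
  exact sum_mul_sq_le_sq_mul_sq _ _ _

lemma abs_pushPairing_le (h : IsCovering X Y pV pW d) (ha : ∀ v', 0 ≤ a v')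
    (hγ : ∀ w', |γ w'| ≤ 1) (w : W) :
    |pushPairing Y pW a γ w| ≤
      pushLength pV d a (X.ini w) * pushLength pV d a (X.ter w) := by
  refine (abs_sum_le_sum_abs _ _).trans (le_trans (sum_le_sum fun w' _ => ?_) (h.sum_mul_le a w))
  have := mul_nonneg (ha (Y.ini w')) (ha (Y.ter w'))
  rw [abs_mul, abs_of_nonneg this]
  exact mul_le_of_le_one_left this (hγ w')

lemma fiber_nonempty (h : IsCovering X Y pV pW d) (w : W) :
    (univ.filter fun w' => pW w' = w).Nonempty := by
  obtain ⟨v', hv'⟩ := h.surjective (X.ini w)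
  have hc := h.card_fiber v' w hv'.symm
  obtain ⟨w', hw'⟩ := card_pos.1 (hc ▸ h.degree_pos v')
  exact ⟨w', by simp_all⟩

lemma abs_pushPairing_lt (h : IsCovering X Y pV pW d) (ha : ∀ v', 0 < a v')
    (hγ : ∀ w', |γ w'| < 1) (w : W) :
    |pushPairing Y pW a γ w| <
      pushLength pV d a (X.ini w) * pushLength pV d a (X.ter w) := by
  refine (abs_sum_le_sum_abs _ _).trans_lt
    (lt_of_lt_of_le (sum_lt_sum_of_nonempty (h.fiber_nonempty w) fun w' _ => ?_)
      (h.sum_mul_le a w))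
  have := mul_pos (ha (Y.ini w')) (ha (Y.ter w'))
  rw [abs_mul, abs_of_pos this]
  exact mul_lt_of_lt_one_left this (hγ w')

lemma pushAngle_symSol (h : IsCovering X Y pV pW d) (hγ : Y.SymSol γ) :
    X.SymSol (pushAngle X Y pV pW d a γ) := by
  intro w
  have hN : pushPairing Y pW a γ (X.rev w) = pushPairing Y pW a γ w := by
    rw [pushPairing, h.sum_fiber_rev]
    refine sum_congr rfl fun w' _ => ?_
    rw [hγ, ter_rev, mul_comm (a (Y.ini (Y.rev w')))]
    rfl
  rw [pushAngle, hN, ter_rev, mul_comm (pushLength pV d a (X.ini (X.rev w)))]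
  rfl

lemma pushAngle_mul (h : IsCovering X Y pV pW d) (w : W) :
    pushAngle X Y pV pW d a γ w *
        (pushLength pV d a (X.ini w) * pushLength pV d a (X.ter w)) =
      pushPairing Y pW a γ w := by
  refine div_mul_cancel_of_imp fun h0 => sum_eq_zero fun w' hw' => ?_
  obtain rfl := (mem_filter.1 hw').2
  rcases mul_eq_zero.1 h0 with h0 | h0
  · rw [← h.map_ini] at h0
    simp [h.eq_zero_of_pushLength_eq_zero h0]
  · rw [← h.map_ter] at h0
    simp [h.eq_zero_of_pushLength_eq_zero h0]

lemma sum_fiber_BKN (h : IsCovering X Y pV pW d) (hE : Y.BKN a γ) (v : V) :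
    X.k v * pushLength pV d a v ^ 2 =
      ∑ w with X.ini w = v, pushPairing Y pW a γ w / (X.b w : ℝ) := by
  have hV : X.k v * pushLength pV d a v ^ 2 = ∑ v' with pV v' = v,
      ∑ w' with Y.ini w' = v', γ w' / (Y.b w' : ℝ) * (a (Y.ini w') * a (Y.ter w')) := by
    rw [sq_pushLength, mul_sum]
    refine sum_congr rfl fun v' hv' => ?_
    obtain rfl := (mem_filter.1 hv').2
    calc X.k (pV v') * (d v' * a v' ^ 2) = Y.k v' * a v' * a v' := by rw [h.map_k]; ring
      _ = _ := by
        rw [hE v', sum_mul]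
        refine sum_congr rfl fun w' hw' => ?_
        rw [(mem_filter.1 hw').2]
        ring
  have hW (w : W) : pushPairing Y pW a γ w / (X.b w : ℝ) =
      ∑ w' with pW w' = w, γ w' / (Y.b w' : ℝ) * (a (Y.ini w') * a (Y.ter w')) := by
    rw [pushPairing, sum_div]
    refine sum_congr rfl fun w' hw' => ?_
    rw [h.map_b, (mem_filter.1 hw').2]
    ring
  simp only [hV, hW, sum_filter]
  simp only [← sum_filter, sum_fiberwise_eq_sum_filter]
  simp [h.map_ini]

lemma push_BKN (h : IsCovering X Y pV pW d) (hE : Y.BKN a γ) :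
    X.BKN (pushLength pV d a) (pushAngle X Y pV pW d a γ) := by
  intro v
  rcases eq_or_ne (pushLength pV d a v) 0 with h0 | h0
  · rw [h0, mul_zero]
    refine (sum_eq_zero fun w hw => ?_).symm
    rw [pushAngle, (mem_filter.1 hw).2, h0]
    simp
  · refine mul_right_cancel₀ h0 ?_
    rw [mul_assoc, ← sq, h.sum_fiber_BKN hE, sum_mul]
    refine sum_congr rfl fun w hw => ?_
    rw [← h.pushAngle_mul, (mem_filter.1 hw).2]
    ring

lemma push_compatible (h : IsCovering X Y pV pW d) (hC : Y.Compatible a γ) (hS : Y.SymSol γ) :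
    X.Compatible (pushLength pV d a) (pushAngle X Y pV pW d a γ) := by
  obtain ⟨ha, hne, hγ, -, -⟩ := hC
  have hsym := h.pushAngle_symSol (a := a) hS
  refine ⟨pushLength_nonneg pV d a, ?_, fun w => ?_, fun w _ => hsym w, fun v hv w hw => ?_⟩
  · obtain ⟨v', hv'⟩ := Function.ne_iff.1 hne
    exact Function.ne_iff.2 ⟨pV v', (h.pushLength_pos hv').ne'⟩
  · have hnn := mul_nonneg (pushLength_nonneg pV d a (X.ini w))
      (pushLength_nonneg pV d a (X.ter w))
    rw [pushAngle, abs_div, abs_of_nonneg hnn]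
    exact div_le_one_of_le₀ (h.abs_pushPairing_le ha hγ w) hnn
  · rw [hsym w, and_self, pushAngle, hw, hv]
    simp

lemma pushLength_pos_of_pos (h : IsCovering X Y pV pW d) (ha : ∀ v', 0 < a v') (v : V) :
    0 < pushLength pV d a v := by
  obtain ⟨v', rfl⟩ := h.surjective v
  exact h.pushLength_pos (ha v').ne'

lemma abs_pushAngle_lt_one (h : IsCovering X Y pV pW d) (ha : ∀ v', 0 < a v')
    (hγ : ∀ w', |γ w'| < 1) (w : W) : |pushAngle X Y pV pW d a γ w| < 1 := by
  have hpos := mul_pos (h.pushLength_pos_of_pos ha (X.ini w))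
    (h.pushLength_pos_of_pos ha (X.ter w))
  rw [pushAngle, abs_div, abs_of_pos hpos, div_lt_one hpos]
  exact h.abs_pushPairing_lt ha hγ w

end IsCovering

end LabeledGraph

open LabeledGraph in
/-- Descent Lemma: given a covering datum from a labeled graph `Y` to a labeled graph `X`
(a surjection of vertices and a map of oriented edges commuting with the orientation
reversal and initial-vertex maps, preserving weights, multiplying charges by the local
degrees `d_ṽ ≥ 1`, and such that above every edge `w ∈ ∂(p ṽ)` there are exactly `d_ṽ`
edges in `∂ṽ`), the existence of a compatible symmetric solution (resp. one with positive
length function, resp. an NPC-solution) of the BKN-equation over `Y` implies the same for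
`X`. -/
theorem descent_lemma
    {V W V' W' : Type} [Fintype V] [DecidableEq V] [Fintype W] [DecidableEq W]
    [Fintype V'] [DecidableEq V'] [Fintype W'] [DecidableEq W']
    (X : LabeledGraph V W) (Y : LabeledGraph V' W')
    (pV : V' → V) (pW : W' → W) (d : V' → ℕ)
    (hpV : Function.Surjective pV)
    (hrev : ∀ w', pW (Y.rev w') = X.rev (pW w'))
    (hini : ∀ w', pV (Y.ini w') = X.ini (pW w'))
    (hd : ∀ v', 0 < d v')
    (hb : ∀ w', Y.b w' = X.b (pW w'))
    (hk : ∀ v', Y.k v' = (d v' : ℝ) * X.k (pV v'))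
    (hfiber : ∀ (v' : V') (w : W), X.ini w = pV v' →
      (univ.filter (fun w' => Y.ini w' = v' ∧ pW w' = w)).card = d v') :
    ((∃ (a : V' → ℝ) (γ : W' → ℝ), Y.BKN a γ ∧ Y.Compatible a γ ∧ Y.SymSol γ) →
      ∃ (a : V → ℝ) (γ : W → ℝ), X.BKN a γ ∧ X.Compatible a γ ∧ X.SymSol γ) ∧
    ((∃ (a : V' → ℝ) (γ : W' → ℝ), Y.BKN a γ ∧ Y.Compatible a γ ∧ Y.SymSol γ ∧
        ∀ v', 0 < a v') →
      ∃ (a : V → ℝ) (γ : W → ℝ), X.BKN a γ ∧ X.Compatible a γ ∧ X.SymSol γ ∧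
        ∀ v, 0 < a v) ∧
    ((∃ (a : V' → ℝ) (γ : W' → ℝ), Y.NPCSolution a γ) →
      ∃ (a : V → ℝ) (γ : W → ℝ), X.NPCSolution a γ) := by
  have h : IsCovering X Y pV pW d := ⟨hpV, hrev, hini, hd, hb, hk, hfiber⟩
  refine ⟨?_, ?_, ?_⟩
  · rintro ⟨a, γ, hE, hC, hS⟩
    exact ⟨_, _, h.push_BKN hE, h.push_compatible hC hS, h.pushAngle_symSol hS⟩
  · rintro ⟨a, γ, hE, hC, hS, ha⟩
    exact ⟨_, _, h.push_BKN hE, h.push_compatible hC hS, h.pushAngle_symSol hS,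
      h.pushLength_pos_of_pos ha⟩
  · rintro ⟨a, γ, hE, hC, hS, ha, hγ⟩
    exact ⟨_, _, h.push_BKN hE, h.push_compatible hC hS, h.pushAngle_symSol hS,
      h.pushLength_pos_of_pos ha, h.abs_pushAngle_lt_one ha hγ⟩
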